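/- Let D ≥ 1 and n ≥ 1 be integers, let Ξ = ∏_{i=1}^{D} [α_i, β_i] with α_i < β_i, and let f : ℝ^D → ℝ be C^∞ on Ξ and satisfy the derivative bound: there exist C_f ≥ 0, γ_f > 0 and an integer σ ≥ 1 such that for all x ∈ Ξ, all 1 ≤ i ≤ D and all integers v ≥ 0, |∂_i^v f(x)| ≤ C_f·(v+σ−1)!/(γ_f^v·(σ−1)!). Let M be the coefficient tensor of samples of f at the tensor grid of scaled Chebyshev nodes, M(i_1,…,i_D) = f(η^{(1)}_{i_1},…,η^{(D)}_{i_D}), and let λ_{n−1} be the Lebesgue constant of the n Chebyshev nodes. Then for every tensor M̂ : {1,…,n}^D → ℝ and every point ξ = (ξ_1,…,ξ_D) ∈ Ξ, | f(ξ) − Σ_{i_1,…,i_D} M̂(i_1,…,i_D)·∏_{j=1}^{D} φ^{[α_j,β_j]}(η^{(j)}_{i_j}, ξ_j) | ≤ E(n) + λ_{n−1}^D · ( max over all multi-indices i of |M(i) − M̂(i)| ). In particular, for any finite sets of source points, parameters and target points lying in their respective boxes, the entrywise (Chebyshev-norm) error between the parametric kernel matrix with entries f(x, θ, y) and the approximation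 with entries given by the contraction of M̂ against the Chebyshev basis vectors is bounded by E(n) + λ_{n−1}^D·‖M − M̂‖_C. -/

import Mathlib

open Real Finset

/-- Chebyshev polynomial of the first kind of degree `m`, evaluated at `x`. -/
noncomputable def chebT (m : ℕ) (x : ℝ) : ℝ :=
  (Polynomial.Chebyshev.T ℝ m).eval x

/-- The Chebyshev nodes of the first kind in `[-1,1]` (indexed by `Fin n`, so that
index `k` corresponds to the node `cos((2(k+1)−1)π/(2n)) = cos((2k+1)π/(2n))`). -/
noncomputable def chebNode (n : ℕ) (k : Fin n) : ℝ :=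
  Real.cos ((2 * (k : ℝ) + 1) * Real.pi / (2 * (n : ℝ)))

/-- The scaled Chebyshev node on `[α, β]`: `η_k = ((α−β)/2)·ζ_k + (α+β)/2`. -/
noncomputable def scaledChebNode (n : ℕ) (α β : ℝ) (k : Fin n) : ℝ :=
  ((α - β) / 2) * chebNode n k + (α + β) / 2

/-- The Chebyshev basis polynomial on `[α, β]`:
`φ^{[α,β]}(η_i, x) = 1/n + (2/n)·Σ_{m=1}^{n−1} T_m(ζ_i)·T_m((2x − (α+β))/(α−β))`. -/
noncomputable def chebBasis (n : ℕ) (α β : ℝ) (i : Fin n) (x : ℝ) : ℝ :=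
  1 / (n : ℝ) + (2 / (n : ℝ)) *
    ∑ m ∈ Finset.Icc 1 (n - 1),
      chebT m (chebNode n i) * chebT m ((2 * x - (α + β)) / (α - β))

/-- The Lebesgue constant `λ_{n−1}` of the `n` Chebyshev nodes:
`sup_{x ∈ [−1,1]} Σ_{k=1}^n ∏_{j≠k} |x − ζ_j| / |ζ_k − ζ_j|`. -/
noncomputable def lebesgueConst (n : ℕ) : ℝ :=
  ⨆ x ∈ Set.Icc (-1 : ℝ) 1,
    ∑ k : Fin n, ∏ j ∈ Finset.univ.erase k,
      |x - chebNode n j| / |chebNode n k - chebNode n j|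

/-- `ς(r) = r + √(1 + r²)`. -/
noncomputable def varsigma (r : ℝ) : ℝ := r + Real.sqrt (1 + r ^ 2)

/-- The error quantity
`E(k) = 2·e·D·C_f·(λ_{k−1}+1)^D·(k+1)^σ·(1 + diam/γ_f)·ς(2γ_f/diam)^{−k}`. -/
noncomputable def Equant (D : ℕ) (Cf γf diam : ℝ) (σ : ℕ) (k : ℕ) : ℝ :=
  2 * Real.exp 1 * (D : ℝ) * Cf * (lebesgueConst k + 1) ^ D * ((k : ℝ) + 1) ^ σ *
    (1 + diam / γf) * (varsigma (2 * γf / diam))⁻¹ ^ k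

open scoped Topology

section TaylorExtension

/-- The Taylor series of the real function `g` at `x`, summed at the complex point `z`. -/
noncomputable def taylorExt (g : ℝ → ℝ) (x : ℝ) (z : ℂ) : ℂ :=
  ∑' v : ℕ, ((iteratedDeriv v g x / (Nat.factorial v : ℝ) : ℝ) : ℂ) * (z - x) ^ v

variable {g : ℝ → ℝ} {C r x : ℝ} {k : ℕ}

theorem abs_div_factorial_mul_pow_le {a s : ℝ} (hr : 0 < r) (hs : 0 ≤ s) (v : ℕ)
    (h : |a| ≤ C * (Nat.factorial (v + k) : ℝ) / (r ^ v * (Nat.factorial k : ℝ))) :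
    |a| / (Nat.factorial v : ℝ) * s ^ v ≤ C * (((v + k).choose k : ℝ) * (s / r) ^ v) := by
  have hchoose : ((v + k).choose k : ℝ) * (Nat.factorial v * Nat.factorial k) =
      Nat.factorial (v + k) := by
    have := Nat.add_choose_mul_factorial_mul_factorial v k
    rw [← mul_assoc]
    exact_mod_cast this
  calc |a| / (Nat.factorial v : ℝ) * s ^ v
      ≤ C * (Nat.factorial (v + k) : ℝ) / (r ^ v * (Nat.factorial k : ℝ)) /
          (Nat.factorial v : ℝ) * s ^ v := by gcongr
    _ = C * (((v + k).choose k : ℝ) * (s / r) ^ v) := by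
      rw [← hchoose, div_pow]
      field_simp

theorem norm_taylorExt_term_le {s : ℝ} (hr : 0 < r) (v : ℕ)
    (h : |iteratedDeriv v g x| ≤ C * (Nat.factorial (v + k) : ℝ) / (r ^ v * (Nat.factorial k : ℝ)))
    {z : ℂ} (hz : ‖z - x‖ ≤ s) :
    ‖((iteratedDeriv v g x / (Nat.factorial v : ℝ) : ℝ) : ℂ) * (z - x) ^ v‖ ≤
      C * (((v + k).choose k : ℝ) * (s / r) ^ v) := by
  rw [norm_mul, norm_pow, Complex.norm_real, Real.norm_eq_abs, abs_div, Nat.abs_cast]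
  refine le_trans ?_ (abs_div_factorial_mul_pow_le hr ((norm_nonneg _).trans hz) v h)
  gcongr

theorem summable_choose_mul_div_pow {s : ℝ} (hs : 0 ≤ s) (hsr : s < r) :
    Summable fun v : ℕ => C * (((v + k).choose k : ℝ) * (s / r) ^ v) := by
  have hq : ‖s / r‖ < 1 := by
    rw [Real.norm_of_nonneg (div_nonneg hs (hs.trans hsr.le)), div_lt_one (hs.trans_lt hsr)]
    exact hsr
  exact (hasSum_choose_mul_geometric_of_norm_lt_one k hq).summable.mul_left C

theorem norm_taylorExt_le {s : ℝ} (hs : 0 ≤ s) (hsr : s < r)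
    (h : ∀ v : ℕ, |iteratedDeriv v g x| ≤
      C * (Nat.factorial (v + k) : ℝ) / (r ^ v * (Nat.factorial k : ℝ)))
    {z : ℂ} (hz : ‖z - x‖ ≤ s) :
    ‖taylorExt g x z‖ ≤ C * (1 - s / r)⁻¹ ^ (k + 1) := by
  have hr : 0 < r := hs.trans_lt hsr
  have hq : ‖s / r‖ < 1 := by
    rw [Real.norm_of_nonneg (div_nonneg hs hr.le), div_lt_one hr]
    exact hsr
  refine tsum_of_norm_bounded ?_ fun v => norm_taylorExt_term_le hr v (h v) hz
  simpa using (hasSum_choose_mul_geometric_of_norm_lt_one k hq).mul_left C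

theorem differentiableOn_taylorExt (h : ∀ v : ℕ, |iteratedDeriv v g x| ≤
      C * (Nat.factorial (v + k) : ℝ) / (r ^ v * (Nat.factorial k : ℝ))) :
    DifferentiableOn ℂ (taylorExt g x) (Metric.ball (x : ℂ) r) := by
  intro z hz
  rw [mem_ball_iff_norm] at hz
  obtain ⟨s, hzs, hsr⟩ := exists_between hz
  have hs : 0 ≤ s := (norm_nonneg _).trans hzs.le
  have hd : DifferentiableOn ℂ (taylorExt g x) (Metric.ball (x : ℂ) s) := by
    refine Complex.differentiableOn_tsum_of_summable_norm
      (summable_choose_mul_div_pow (C := C) (k := k) hs hsr) (fun v => by fun_prop)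
      Metric.isOpen_ball fun v w hw => ?_
    rw [mem_ball_iff_norm] at hw
    exact norm_taylorExt_term_le (hs.trans_lt hsr) v (h v) hw.le
  exact (hd.differentiableAt (Metric.isOpen_ball.mem_nhds
    (mem_ball_iff_norm.mpr hzs))).differentiableWithinAt

variable {I : Set ℝ}

theorem taylorExt_ofReal (hI : IsOpen I) (hconv : I.OrdConnected) (hg : ContDiffOn ℝ (⊤ : ℕ∞) g I)
    (h : ∀ y ∈ I, ∀ v : ℕ, |iteratedDeriv v g y| ≤
      C * (Nat.factorial (v + k) : ℝ) / (r ^ v * (Nat.factorial k : ℝ)))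
    (hx : x ∈ I) {t : ℝ} (ht : t ∈ I) (htr : |t - x| < r) :
    taylorExt g x t = g t := by
  have hr : 0 < r := (abs_nonneg _).trans_lt htr
  have hsum := summable_choose_mul_div_pow (C := C) (k := k) (abs_nonneg (t - x)) htr
  have hnorm : ‖((t : ℂ) - x)‖ = |t - x| := by
    rw [← Complex.ofReal_sub, Complex.norm_real, Real.norm_eq_abs]
  have hterm : Summable fun v : ℕ =>
      ((iteratedDeriv v g x / (Nat.factorial v : ℝ) : ℝ) : ℂ) * ((t : ℂ) - x) ^ v :=
    hsum.of_norm_bounded fun v => norm_taylorExt_term_le hr v (h x hx v) hnorm.le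
  refine tendsto_nhds_unique
    (hterm.hasSum.tendsto_sum_nat.comp (Filter.tendsto_add_atTop_nat 1)) ?_
  rw [tendsto_iff_norm_sub_tendsto_zero]
  refine squeeze_zero (fun _ => norm_nonneg _) (fun N => ?_)
    (hsum.tendsto_atTop_zero.comp (Filter.tendsto_add_atTop_nat 1))
  rcases eq_or_ne x t with rfl | hxt
  · simp [Finset.sum_range_succ']
  have hsub : Set.uIcc x t ⊆ I := hconv.uIcc_subset hx ht
  obtain ⟨y, hy, hrem⟩ := taylor_mean_remainder_lagrange_iteratedDeriv (n := N) hxt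
    ((hg.mono hsub).of_le (by exact_mod_cast le_top))
  have hyI : y ∈ I := hsub (Set.uIoo_subset_uIcc_self hy)
  have hpoly : taylorWithinEval g N (Set.uIcc x t) x t =
      ∑ v ∈ Finset.range (N + 1), iteratedDeriv v g x / (Nat.factorial v : ℝ) * (t - x) ^ v := by
    rw [taylor_within_apply]
    refine Finset.sum_congr rfl fun v _ => ?_
    rw [iteratedDerivWithin_eq_iteratedDeriv (uniqueDiffOn_uIcc hxt)
      (((hg x hx).contDiffAt (hI.mem_nhds hx)).of_le (by exact_mod_cast le_top))
      Set.left_mem_uIcc, smul_eq_mul]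
    ring
  have hcast : ∑ v ∈ Finset.range (N + 1),
      ((iteratedDeriv v g x / (Nat.factorial v : ℝ) : ℝ) : ℂ) * ((t : ℂ) - x) ^ v - (g t : ℂ) =
      ((-(g t - taylorWithinEval g N (Set.uIcc x t) x t) : ℝ) : ℂ) := by
    rw [hpoly]
    push_cast
    ring
  simp only [Function.comp_apply]
  rw [hcast, hrem, Complex.norm_real, Real.norm_eq_abs, abs_neg, abs_div, abs_mul, abs_pow,
    Nat.abs_cast, mul_div_right_comm]
  exact abs_div_factorial_mul_pow_le hr (abs_nonneg _) (N + 1) (h y hyI (N + 1))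

theorem taylorExt_eqOn_inter (hI : IsOpen I) (hconv : I.OrdConnected)
    (hg : ContDiffOn ℝ (⊤ : ℕ∞) g I)
    (h : ∀ y ∈ I, ∀ v : ℕ, |iteratedDeriv v g y| ≤
      C * (Nat.factorial (v + k) : ℝ) / (r ^ v * (Nat.factorial k : ℝ)))
    (hx : x ∈ I) {y : ℝ} (hy : y ∈ I) :
    Set.EqOn (taylorExt g x) (taylorExt g y) (Metric.ball (x : ℂ) r ∩ Metric.ball (y : ℂ) r) := by
  intro z hz
  have hxy : |x - y| < 2 * r := by
    rw [← Real.norm_eq_abs, ← Complex.norm_real, Complex.ofReal_sub, ← dist_eq_norm]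
    have h1 := Metric.mem_ball.mp hz.1
    have h2 := Metric.mem_ball.mp hz.2
    have h3 := dist_triangle_left (x : ℂ) y z
    linarith
  set m : ℝ := (x + y) / 2 with hm
  have hmI : m ∈ I := hconv.uIcc_subset hx hy (by
    rw [Set.mem_uIcc]
    rcases le_total x y with hle | hle
    · exact Or.inl ⟨by linarith, by linarith⟩
    · exact Or.inr ⟨by linarith, by linarith⟩)
  have hmx : |m - x| < r := by
    rw [abs_lt] at hxy ⊢
    constructor <;> linarith
  have hmy : |m - y| < r := by
    rw [abs_lt] at hxy ⊢
    constructor <;> linarith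
  have hball : ∀ t a : ℝ, |t - a| < r → (t : ℂ) ∈ Metric.ball (a : ℂ) r := fun t a hta => by
    rw [mem_ball_iff_norm, ← Complex.ofReal_sub, Complex.norm_real, Real.norm_eq_abs]
    exact hta
  have hopen : IsOpen (Metric.ball (x : ℂ) r ∩ Metric.ball (y : ℂ) r) :=
    Metric.isOpen_ball.inter Metric.isOpen_ball
  refine AnalyticOnNhd.eqOn_of_preconnected_of_frequently_eq
    (((differentiableOn_taylorExt (h x hx)).mono Set.inter_subset_left).analyticOnNhd hopen)
    (((differentiableOn_taylorExt (h y hy)).mono Set.inter_subset_right).analyticOnNhd hopen)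
    ((convex_ball _ _).inter (convex_ball _ _)).isPreconnected
    (z₀ := (m : ℂ)) ⟨hball m x hmx, hball m y hmy⟩ ?_ hz
  have hreal : ∀ᶠ t : ℝ in 𝓝[≠] m, taylorExt g x t = taylorExt g y t := by
    refine Filter.Eventually.filter_mono nhdsWithin_le_nhds ?_
    have hcont : ∀ a : ℝ, Continuous fun t : ℝ => |t - a| := fun a => by fun_prop
    filter_upwards [hI.mem_nhds hmI, ((hcont x).tendsto m).eventually_lt_const hmx,
      ((hcont y).tendsto m).eventually_lt_const hmy] with t ht htx hty
    rw [taylorExt_ofReal hI hconv hg h hx ht htx, taylorExt_ofReal hI hconv hg h hy ht hty]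
  have hmap : Filter.Tendsto (fun t : ℝ => (t : ℂ)) (𝓝[≠] m) (𝓝[≠] (m : ℂ)) :=
    Complex.continuous_ofReal.continuousWithinAt.tendsto_nhdsWithin fun t ht => by
      simpa using ht
  exact hmap.frequently hreal.frequently

/-- A smooth function on an open interval whose derivatives grow like those of a function with
radius of convergence `r` extends to the `r`-neighbourhood of the interval in the complex plane,
as the common value of its Taylor series. -/
theorem exists_forall_eqOn_taylorExt (hI : IsOpen I) (hconv : I.OrdConnected)
    (hg : ContDiffOn ℝ (⊤ : ℕ∞) g I)
    (h : ∀ y ∈ I, ∀ v : ℕ, |iteratedDeriv v g y| ≤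
      C * (Nat.factorial (v + k) : ℝ) / (r ^ v * (Nat.factorial k : ℝ))) :
    ∃ G : ℂ → ℂ, ∀ x ∈ I, Set.EqOn G (taylorExt g x) (Metric.ball (x : ℂ) r) := by
  classical
  refine ⟨fun z => if hz : ∃ y ∈ I, z ∈ Metric.ball (y : ℂ) r
    then taylorExt g hz.choose z else 0, fun x hx z hz => ?_⟩
  have hex : ∃ y ∈ I, z ∈ Metric.ball (y : ℂ) r := ⟨x, hx, hz⟩
  simp only [dif_pos hex]
  exact taylorExt_eqOn_inter hI hconv hg h hex.choose_spec.1 hx ⟨hex.choose_spec.2, hz⟩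

end TaylorExtension

section Laurent

variable {H : ℂ → ℂ} {ρ M : ℝ}

theorem norm_circleIntegral_mul_zpow_le (hρ : 1 < ρ)
    (hd : ∀ w : ℂ, ρ⁻¹ ≤ ‖w‖ → ‖w‖ ≤ ρ → DifferentiableAt ℂ H w)
    (hM : ∀ w : ℂ, ρ⁻¹ ≤ ‖w‖ → ‖w‖ ≤ ρ → ‖H w‖ ≤ M) (k : ℤ) :
    ‖∮ w in C(0, 1), H w * w ^ (-k - 1)‖ ≤ 2 * π * (M * ρ⁻¹ ^ k.natAbs) := by
  have hρ0 : 0 < ρ := one_pos.trans hρ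
  have hρ1 : ρ⁻¹ ≤ 1 := inv_le_one_of_one_le₀ hρ.le
  have hdiff : ∀ w : ℂ, ρ⁻¹ ≤ ‖w‖ → ‖w‖ ≤ ρ →
      DifferentiableAt ℂ (fun w => H w * w ^ (-k - 1)) w := fun w h1 h2 =>
    (hd w h1 h2).mul (differentiableAt_zpow.mpr
      (Or.inl (norm_pos_iff.mp ((inv_pos.mpr hρ0).trans_le h1))))
  have hbound : ∀ R : ℝ, ρ⁻¹ ≤ R → R ≤ ρ →
      ‖∮ w in C(0, R), H w * w ^ (-k - 1)‖ ≤ 2 * π * (M * R ^ (-k)) := fun R h1 h2 => by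
    have hR : 0 < R := (inv_pos.mpr hρ0).trans_le h1
    have := circleIntegral.norm_integral_le_of_norm_le_const (c := 0) (R := R) hR.le
      (f := fun w => H w * w ^ (-k - 1)) (C := M * R ^ (-k - 1)) fun w hw => by
        rw [mem_sphere_zero_iff_norm] at hw
        rw [norm_mul, norm_zpow, hw]
        exact mul_le_mul_of_nonneg_right (hM w (hw ▸ h1) (hw ▸ h2)) (zpow_nonneg hR.le _)
    refine this.trans_eq ?_
    rw [zpow_sub_one₀ hR.ne']
    field_simp
  have hannulus : ∀ r R : ℝ, ρ⁻¹ ≤ r → r ≤ R → R ≤ ρ →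
      (∮ w in C(0, R), H w * w ^ (-k - 1)) = ∮ w in C(0, r), H w * w ^ (-k - 1) :=
    fun r R h1 h2 h3 => by
      refine Complex.circleIntegral_eq_of_differentiable_on_annulus_off_countable
        ((inv_pos.mpr hρ0).trans_le h1) h2 Set.countable_empty (fun w hw => ?_) fun w hw => ?_
      · simp only [Set.mem_sdiff, mem_closedBall_zero_iff, mem_ball_zero_iff, not_lt] at hw
        exact (hdiff w (h1.trans hw.2) (hw.1.trans h3)).continuousAt.continuousWithinAt
      · simp only [Set.mem_sdiff, mem_closedBall_zero_iff, mem_ball_zero_iff, not_le] at hw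
        exact hdiff w (h1.trans hw.1.2.le) (hw.1.1.le.trans h3)
  rcases Int.natAbs_eq k with hk | hk
  · rw [← hannulus 1 ρ hρ1 hρ.le le_rfl]
    convert hbound ρ (hρ1.trans hρ.le) le_rfl using 3
    rw [hk, zpow_neg, zpow_natCast, inv_pow, Int.natAbs_natCast]
  · rw [hannulus ρ⁻¹ 1 le_rfl hρ1 hρ.le]
    convert hbound ρ⁻¹ le_rfl (hρ1.trans hρ.le) using 3
    rw [hk, neg_neg, zpow_natCast, Int.natAbs_neg, Int.natAbs_natCast]

theorem summable_pow_natAbs {q : ℝ} (hq0 : 0 ≤ q) (hq : q < 1) :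
    Summable fun k : ℤ => q ^ k.natAbs := by
  refine Summable.of_nat_of_neg ?_ ?_ <;>
  simpa using summable_geometric_of_lt_one hq0 hq

/-- The Laurent coefficients on the unit circle of a function holomorphic and bounded by `M` on
the closed annulus `ρ⁻¹ ≤ ‖w‖ ≤ ρ` decay geometrically. -/
theorem exists_hasSum_laurent (hρ : 1 < ρ)
    (hd : ∀ w : ℂ, ρ⁻¹ ≤ ‖w‖ → ‖w‖ ≤ ρ → DifferentiableAt ℂ H w)
    (hM : ∀ w : ℂ, ρ⁻¹ ≤ ‖w‖ → ‖w‖ ≤ ρ → ‖H w‖ ≤ M) :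
    ∃ c : ℤ → ℂ, (∀ k, ‖c k‖ ≤ M * ρ⁻¹ ^ k.natAbs) ∧
      ∀ θ : ℝ, HasSum (fun k : ℤ => c k * Complex.exp (k * θ * Complex.I))
        (H (Complex.exp (θ * Complex.I))) := by
  have hρ0 : 0 < ρ := one_pos.trans hρ
  have hρ1 : ρ⁻¹ ≤ 1 := inv_le_one_of_one_le₀ hρ.le
  have : Fact (0 < 2 * π) := ⟨Real.two_pi_pos⟩
  have hpi : (2 * (π : ℂ)) ≠ 0 := by exact_mod_cast Real.two_pi_pos.ne'
  have hfour : ∀ (k : ℤ) (θ : ℝ),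
      fourier k (θ : AddCircle (2 * π)) = Complex.exp (k * θ * Complex.I) := fun k θ => by
    rw [fourier_coe_apply]
    congr 1
    push_cast
    field_simp
  have hnorm : ∀ y : AddCircle (2 * π), ‖fourier 1 y‖ = 1 := fun y => Circle.norm_coe _
  let F : C(AddCircle (2 * π), ℂ) := ⟨fun y => H (fourier 1 y), by
    rw [continuous_iff_continuousAt]
    intro y
    refine ContinuousAt.comp (hd _ ?_ ?_).continuousAt (fourier 1).continuous.continuousAt
    · rw [hnorm]; exact hρ1
    · rw [hnorm]; exact hρ.le⟩
  have hF : ∀ θ : ℝ, F (θ : AddCircle (2 * π)) = H (Complex.exp (θ * Complex.I)) := fun θ => by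
    change H (fourier 1 (θ : AddCircle (2 * π))) = _
    rw [hfour, Int.cast_one, one_mul]
  have hcoeff : ∀ k : ℤ, ‖fourierCoeff F k‖ ≤ M * ρ⁻¹ ^ k.natAbs := fun k => by
    have hint : ∮ w in C(0, 1), H w * w ^ (-k - 1) =
        Complex.I * ∫ θ in (0 : ℝ)..0 + 2 * π, fourier (-k) (θ : AddCircle (2 * π)) • F θ := by
      rw [circleIntegral, zero_add, ← intervalIntegral.integral_const_mul]
      refine intervalIntegral.integral_congr fun θ _ => ?_
      have hexp : Complex.exp (θ * Complex.I) ≠ 0 := Complex.exp_ne_zero _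
      simp only [deriv_circleMap, circleMap, zero_add, Complex.ofReal_one, one_mul, smul_eq_mul]
      rw [hF, hfour, zpow_sub_one₀ hexp, ← Complex.exp_int_mul]
      field_simp
    have hle := norm_circleIntegral_mul_zpow_le hρ hd hM k
    rw [hint, norm_mul, Complex.norm_I, one_mul] at hle
    rw [fourierCoeff_eq_intervalIntegral _ _ 0, norm_smul, Real.norm_of_nonneg (by positivity),
      one_div, inv_mul_le_iff₀ Real.two_pi_pos]
    exact hle
  have hsum : Summable (fourierCoeff F) :=
    ((summable_pow_natAbs (inv_nonneg.mpr hρ0.le)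
      (inv_lt_one_of_one_lt₀ hρ)).mul_left M).of_norm_bounded hcoeff
  refine ⟨fourierCoeff F, hcoeff, fun θ => ?_⟩
  have := has_pointwise_sum_fourier_series_of_summable hsum (θ : AddCircle (2 * π))
  simpa only [hF, hfour, smul_eq_mul] using this

end Laurent

section ChebyshevTruncation

variable {G : ℂ → ℂ} {ρ M : ℝ}

open Polynomial in
/-- Truncating the Chebyshev expansion of a function holomorphic on the Bernstein ellipse with
parameter `ρ`, parametrized by the Joukowski map. -/
theorem exists_polynomial_near_of_joukowski (hρ : 1 < ρ)
    (hd : ∀ w : ℂ, ρ⁻¹ ≤ ‖w‖ → ‖w‖ ≤ ρ → DifferentiableAt ℂ G ((w + w⁻¹) / 2))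
    (hM : ∀ w : ℂ, ρ⁻¹ ≤ ‖w‖ → ‖w‖ ≤ ρ → ‖G ((w + w⁻¹) / 2)‖ ≤ M) {n : ℕ} (hn : 1 ≤ n) :
    ∃ P : ℝ[X], P.degree < n ∧ ∀ x ∈ Set.Icc (-1 : ℝ) 1,
      |(G x).re - P.eval x| ≤ 2 * M * ρ⁻¹ ^ n * (1 - ρ⁻¹)⁻¹ := by
  have hρ0 : 0 < ρ := one_pos.trans hρ
  obtain ⟨c, hc, hsum⟩ := exists_hasSum_laurent (H := fun w => G ((w + w⁻¹) / 2)) hρ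
    (fun w h1 h2 => by
      have hw : w ≠ 0 := norm_pos_iff.mp ((inv_pos.mpr hρ0).trans_le h1)
      exact DifferentiableAt.comp w (hd w h1 h2)
        ((differentiableAt_id.add (differentiableAt_inv hw)).div_const 2)) hM
  set d : ℕ → ℝ := fun k => (c k).re + (c (-k)).re with hd_def
  have hd_le : ∀ k : ℕ, |d k| ≤ 2 * M * ρ⁻¹ ^ k := fun k => by
    have h1 := (Complex.abs_re_le_norm _).trans (hc k)
    have h2 := (Complex.abs_re_le_norm _).trans (hc (-k))
    rw [Int.natAbs_neg] at h2
    rw [Int.natAbs_natCast] at h1 h2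
    refine (abs_add_le _ _).trans ?_
    linarith
  have hT : ∀ θ : ℝ, HasSum (fun k : ℕ => d k * (Chebyshev.T ℝ k).eval (Real.cos θ))
      ((G (Real.cos θ)).re + (c 0).re) := fun θ => by
    have hcos : ∀ s : ℝ, (Complex.exp (s * Complex.I) + (Complex.exp (s * Complex.I))⁻¹) / 2 =
        Complex.cos s := fun s => by
      rw [Complex.cos, ← Complex.exp_neg, neg_mul]
    have h1 := hsum θ
    have h2 := hsum (-θ)
    simp only [hcos] at h1 h2
    simp only [Complex.ofReal_neg, Complex.cos_neg] at h2
    have h3 := Complex.hasSum_re ((h1.add h2).div_const 2)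
    have h4 := h3.nat_add_neg
    convert h4 using 1
    · funext k
      have hk : ∀ j : ℤ, (c j * Complex.exp (j * θ * Complex.I) +
          c j * Complex.exp (j * -θ * Complex.I)) / 2 =
          c j * ((Real.cos (j * θ) : ℝ) : ℂ) := fun j => by
        rw [Complex.ofReal_cos, Complex.cos]
        push_cast
        ring_nf
      rw [hk, hk, Complex.re_mul_ofReal, Complex.re_mul_ofReal, Polynomial.Chebyshev.T_real_cos]
      push_cast
      rw [neg_mul, Real.cos_neg]
      ring
    · simp
  refine ⟨∑ k ∈ Finset.range n, C (d k) * Chebyshev.T ℝ k - C (c 0).re, ?_, fun x hx => ?_⟩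
  · refine (degree_sub_le _ _).trans_lt (max_lt ?_ ?_)
    · refine (degree_sum_le _ _).trans_lt ((Finset.sup_lt_iff (WithBot.bot_lt_coe n)).mpr ?_)
      intro k hk
      rw [← smul_eq_C_mul]
      refine (degree_smul_le _ _).trans_lt ?_
      rw [Chebyshev.degree_T, Int.natAbs_natCast]
      exact Nat.cast_lt.mpr (Finset.mem_range.mp hk)
    · exact degree_C_le.trans_lt (by exact_mod_cast hn)
  · have hx' := hT (Real.arccos x)
    rw [Real.cos_arccos hx.1 hx.2] at hx'
    have htail := (hasSum_nat_add_iff' n).mpr hx'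
    have hgeom := (hasSum_geometric_of_lt_one (inv_nonneg.mpr hρ0.le)
      (inv_lt_one_of_one_lt₀ hρ)).mul_left (2 * M * ρ⁻¹ ^ n)
    have := htail.norm_le_of_bounded hgeom fun k => by
      have hTle := Chebyshev.abs_eval_T_real_le_one ((k + n : ℕ) : ℤ) (abs_le.mpr hx)
      rw [Real.norm_eq_abs, abs_mul]
      calc |d (k + n)| * |(Chebyshev.T ℝ ((k + n : ℕ) : ℤ)).eval x| ≤ |d (k + n)| * 1 := by gcongr
        _ ≤ 2 * M * ρ⁻¹ ^ (k + n) := by rw [mul_one]; exact hd_le _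
        _ = 2 * M * ρ⁻¹ ^ n * ρ⁻¹ ^ k := by ring
    rw [Real.norm_eq_abs] at this
    convert this using 2
    simp only [eval_sub, eval_finsetSum, eval_mul, eval_C]
    ring

end ChebyshevTruncation

section Varsigma

theorem one_add_le_varsigma (s : ℝ) : 1 + s ≤ varsigma s := by
  have : 1 ≤ Real.sqrt (1 + s ^ 2) := Real.one_le_sqrt.mpr (by nlinarith)
  rw [varsigma]
  linarith

theorem varsigma_pos (s : ℝ) : 0 < varsigma s := by
  have h := Real.lt_sqrt_of_sq_lt (show (-s) ^ 2 < 1 + s ^ 2 by linarith [neg_sq s])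
  rw [varsigma]
  linarith

theorem varsigma_sub_inv (s : ℝ) : varsigma s - (varsigma s)⁻¹ = 2 * s := by
  have h := Real.sq_sqrt (show 0 ≤ 1 + s ^ 2 by positivity)
  have hinv : (varsigma s)⁻¹ = Real.sqrt (1 + s ^ 2) - s := by
    refine inv_eq_of_mul_eq_one_right ?_
    rw [varsigma]
    linear_combination h
  rw [hinv, varsigma]
  ring

theorem varsigma_mono {s t : ℝ} (hs : 0 ≤ s) (hst : s ≤ t) : varsigma s ≤ varsigma t := by
  have := pow_le_pow_left₀ hs hst 2
  unfold varsigma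
  gcongr

theorem mul_varsigma_le {t r : ℝ} (ht0 : 0 ≤ t) (ht1 : t ≤ 1) :
    t * varsigma r ≤ varsigma (t * r) := by
  have : t * Real.sqrt (1 + r ^ 2) ≤ Real.sqrt (1 + (t * r) ^ 2) := by
    refine Real.le_sqrt_of_sq_le ?_
    rw [mul_pow, Real.sq_sqrt (by positivity)]
    nlinarith
  rw [varsigma, varsigma, mul_add]
  linarith

end Varsigma

section BernsteinEllipse

/-- The image of the annulus `ρ⁻¹ ≤ ‖w‖ ≤ ρ`, `ρ = varsigma s`, under the Joukowski map lies
within distance `s` of the open interval `(-1, 1)`. -/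
theorem exists_norm_joukowski_sub_le {s : ℝ} (hs : 0 < s) {w : ℂ} (h1 : (varsigma s)⁻¹ ≤ ‖w‖)
    (h2 : ‖w‖ ≤ varsigma s) :
    ∃ x ∈ Set.Ioo (-1 : ℝ) 1, ‖(w + w⁻¹) / 2 - (x : ℂ)‖ ≤ s := by
  set ρ := varsigma s with hρ
  have hρ1 : 1 < ρ := by linarith [one_add_le_varsigma s]
  have hρ0 : 0 < ρ := one_pos.trans hρ1
  have hsub : ρ - ρ⁻¹ = 2 * s := varsigma_sub_inv s
  set R := ‖w‖ with hR
  have hR0 : 0 < R := (inv_pos.mpr hρ0).trans_le h1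
  have hRinv : R⁻¹ ≤ ρ := inv_le_of_inv_le₀ hρ0 h1
  have hRinv' : ρ⁻¹ ≤ R⁻¹ := inv_anti₀ hR0 h2
  have hRR : R * R⁻¹ = 1 := mul_inv_cancel₀ hR0.ne'
  set a : ℝ := (R + R⁻¹) / 2 with ha
  set b : ℝ := (R - R⁻¹) / 2 with hb
  have hab : a ^ 2 = 1 + b ^ 2 := by
    rw [ha, hb]
    linear_combination hRR
  have hbs : b ^ 2 ≤ s ^ 2 := by
    refine sq_le_sq' ?_ ?_ <;> rw [hb] <;> linarith
  set A : ℝ := Real.sqrt (1 + s ^ 2) with hA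
  have hAA : A ^ 2 = 1 + s ^ 2 := Real.sq_sqrt (by positivity)
  have hA0 : 0 < A := by positivity
  have hA1 : 1 < A := by nlinarith
  have ha0 : 0 < a := by positivity
  have ha1 : 1 ≤ a := by nlinarith
  have haA : a ≤ A := by nlinarith
  set c := Real.cos w.arg with hc
  set d := Real.sin w.arg with hd
  have hcd : d ^ 2 + c ^ 2 = 1 := Real.sin_sq_add_cos_sq _
  have hw : w = R * (c + d * Complex.I) := by
    rw [hc, hd, Complex.ofReal_cos, Complex.ofReal_sin]
    exact (Complex.norm_mul_cos_add_sin_mul_I w).symm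
  have hcc : ((d : ℂ) ^ 2 + (c : ℂ) ^ 2) = 1 := by exact_mod_cast hcd
  have hwinv : w⁻¹ = (R⁻¹ : ℝ) * (c - d * Complex.I) := by
    refine inv_eq_of_mul_eq_one_right ?_
    have hRC : (R : ℂ) * ((R⁻¹ : ℝ) : ℂ) = 1 := by exact_mod_cast hRR
    rw [hw]
    linear_combination (c ^ 2 - d ^ 2 * Complex.I ^ 2) * hRC - d ^ 2 * Complex.I_sq + hcc
  have hz : (w + w⁻¹) / 2 - ((c / A : ℝ) : ℂ) =
      ((a - A⁻¹) * c : ℝ) + ((b * d : ℝ) : ℂ) * Complex.I := by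
    rw [hwinv]
    nth_rewrite 1 [hw]
    rw [ha, hb, div_eq_mul_inv c A]
    push_cast
    ring
  have hc1 : |c| ≤ 1 := Real.abs_cos_le_one _
  refine ⟨c / A, abs_lt.mp ?_, ?_⟩
  · rw [abs_div, abs_of_pos hA0, div_lt_one hA0]
    exact hc1.trans_lt hA1
  · rw [hz, Complex.norm_add_mul_I]
    refine Real.sqrt_le_iff.mpr ⟨hs.le, ?_⟩
    have hAinv : A⁻¹ ≤ 1 := inv_le_one_of_one_le₀ hA1.le
    have hAAinv : A * A⁻¹ = 1 := mul_inv_cancel₀ hA0.ne'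
    have hAs : A - A⁻¹ ≤ s := by
      have hsA : s ≤ A := Real.le_sqrt_of_sq_le (by linarith)
      refine le_of_mul_le_mul_right ?_ hA0
      calc (A - A⁻¹) * A = s * s := by linear_combination hAA - hAAinv
        _ ≤ s * A := by gcongr
    have haAs : (a - A⁻¹) ^ 2 ≤ s ^ 2 := by
      exact sq_le_sq' (by linarith only [hs, ha1, hAinv]) (by linarith only [haA, hAs])
    rw [mul_pow, mul_pow]
    calc (a - A⁻¹) ^ 2 * c ^ 2 + b ^ 2 * d ^ 2 ≤ s ^ 2 * c ^ 2 + s ^ 2 * d ^ 2 := by gcongr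
      _ = s ^ 2 := by linear_combination s ^ 2 * hcd

open Polynomial in
/-- Polynomial approximation of a smooth function on `[-1, 1]` with derivative growth
`C (v + k)! / (r ^ v k!)`. -/
theorem exists_polynomial_near_of_iteratedDeriv_le {g : ℝ → ℝ} {C r : ℝ} {k n : ℕ} (hC : 0 ≤ C)
    (hr : 0 < r) (hn : 1 ≤ n) (hcont : ContinuousOn g (Set.Icc (-1) 1))
    (hg : ContDiffOn ℝ (⊤ : ℕ∞) g (Set.Ioo (-1) 1))
    (h : ∀ y ∈ Set.Ioo (-1 : ℝ) 1, ∀ v : ℕ, |iteratedDeriv v g y| ≤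
      C * (Nat.factorial (v + k) : ℝ) / (r ^ v * (Nat.factorial k : ℝ))) :
    ∃ P : ℝ[X], P.degree < n ∧ ∀ x ∈ Set.Icc (-1 : ℝ) 1, |g x - P.eval x| ≤
      2 * Real.exp 1 * C * ((n : ℝ) + 1) ^ (k + 1) * (1 + 2 / r) * (varsigma r)⁻¹ ^ n := by
  obtain ⟨G, hG⟩ := exists_forall_eqOn_taylorExt isOpen_Ioo Set.ordConnected_Ioo hg h
  have hn1 : (1 : ℝ) ≤ n := by exact_mod_cast hn
  set t : ℝ := n / (n + 1) with ht
  have ht0 : 0 < t := by positivity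
  have ht1 : t < 1 := (div_lt_one (by positivity)).mpr (lt_add_one _)
  have ht2 : 1 / 2 ≤ t := by
    rw [ht, div_le_div_iff₀ two_pos (by positivity)]
    linarith
  set s : ℝ := t * r with hs_def
  have hs : 0 < s := mul_pos ht0 hr
  have hsr : s < r := by nlinarith
  set ρ := varsigma s with hρ_def
  have hρs : 1 + s ≤ ρ := one_add_le_varsigma s
  have hρ : 1 < ρ := by linarith
  have hfact : (1 - s / r)⁻¹ = n + 1 := by
    rw [hs_def, mul_div_cancel_right₀ _ hr.ne', ht]
    field_simp
    simp
  have hmem : ∀ {x : ℝ} {z : ℂ}, ‖z - x‖ ≤ s → z ∈ Metric.ball (x : ℂ) r := fun hz =>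
    mem_ball_iff_norm.mpr (hz.trans_lt hsr)
  obtain ⟨P, hdeg, hP⟩ := exists_polynomial_near_of_joukowski (G := G)
    (M := C * ((n : ℝ) + 1) ^ (k + 1)) hρ
    (fun w h1 h2 => by
      obtain ⟨x, hx, hz⟩ := exists_norm_joukowski_sub_le hs h1 h2
      exact (((differentiableOn_taylorExt (h x hx)).congr (hG x hx)).differentiableAt
        (Metric.isOpen_ball.mem_nhds (hmem hz))))
    (fun w h1 h2 => by
      obtain ⟨x, hx, hz⟩ := exists_norm_joukowski_sub_le hs h1 h2
      rw [hG x hx (hmem hz), ← hfact]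
      exact norm_taylorExt_le hs.le hsr (h x hx) hz) hn
  refine ⟨P, hdeg, fun x hx => ?_⟩
  have hIoo : ∀ y ∈ Set.Ioo (-1 : ℝ) 1, |g y - P.eval y| ≤
      2 * (C * ((n : ℝ) + 1) ^ (k + 1)) * ρ⁻¹ ^ n * (1 - ρ⁻¹)⁻¹ := fun y hy => by
    have hGy : G y = g y := by
      rw [hG y hy (Metric.mem_ball_self hr)]
      exact taylorExt_ofReal isOpen_Ioo Set.ordConnected_Ioo hg h hy hy (by simpa using hr)
    simpa [hGy] using hP y (Set.Ioo_subset_Icc_self hy)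
  have hclosure : |g x - P.eval x| ≤
      2 * (C * ((n : ℝ) + 1) ^ (k + 1)) * ρ⁻¹ ^ n * (1 - ρ⁻¹)⁻¹ := by
    rw [← closure_Ioo (by norm_num : (-1 : ℝ) ≠ 1)] at hx hcont
    refine le_on_closure (f := fun x => |g x - P.eval x|) hIoo ?_ continuousOn_const hx
    exact (hcont.sub P.continuous.continuousOn).abs
  refine hclosure.trans ?_
  have hρ0 : 0 < ρ := one_pos.trans hρ
  have hinv : (1 - ρ⁻¹)⁻¹ ≤ 1 + 2 / r := by
    have hρ_sub : 0 < ρ - 1 := by linarith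
    have h1 : (1 - ρ⁻¹)⁻¹ = 1 + 1 / (ρ - 1) := by
      field_simp
      ring
    rw [h1]
    gcongr 1 + ?_
    rw [div_le_div_iff₀ hρ_sub hr]
    nlinarith
  have hpow : ρ⁻¹ ^ n ≤ Real.exp 1 * (varsigma r)⁻¹ ^ n := by
    have hςr := varsigma_pos r
    have h1 : ρ⁻¹ ≤ t⁻¹ * (varsigma r)⁻¹ := by
      rw [← mul_inv]
      exact inv_anti₀ (mul_pos ht0 hςr) (mul_varsigma_le ht0.le ht1.le)
    have h2 : t⁻¹ ^ n ≤ Real.exp 1 := by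
      have h3 : t⁻¹ = 1 / (n : ℝ) + 1 := by
        rw [ht]
        field_simp
        ring
      calc t⁻¹ ^ n ≤ Real.exp (1 / (n : ℝ)) ^ n := by
            rw [h3]
            gcongr
            exact Real.add_one_le_exp _
        _ = Real.exp 1 := by
            rw [← Real.exp_nat_mul]
            congr 1
            field_simp
    calc ρ⁻¹ ^ n ≤ (t⁻¹ * (varsigma r)⁻¹) ^ n := by gcongr
      _ = t⁻¹ ^ n * (varsigma r)⁻¹ ^ n := mul_pow _ _ _
      _ ≤ _ := by gcongr
  have hςr := varsigma_pos r
  have hinv0 : 0 ≤ (1 - ρ⁻¹)⁻¹ :=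
    inv_nonneg.mpr (sub_nonneg.mpr (inv_le_one_of_one_le₀ hρ.le))
  calc 2 * (C * ((n : ℝ) + 1) ^ (k + 1)) * ρ⁻¹ ^ n * (1 - ρ⁻¹)⁻¹
      ≤ 2 * (C * ((n : ℝ) + 1) ^ (k + 1)) * (Real.exp 1 * (varsigma r)⁻¹ ^ n) * (1 + 2 / r) := by
        gcongr
    _ = _ := by ring

end BernsteinEllipse

section ChebyshevInterpolation

variable {n : ℕ}

theorem two_mul_sum_range_cos {a : ℝ} {p : ℤ} (ha : n * a = p * π) (hsin : Real.sin (a / 2) ≠ 0) :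
    2 * ∑ m ∈ Finset.range n, Real.cos (m * a) = 1 - (-1) ^ p := by
  have h := Real.sin_mul_sum_cos n a 0
  have harg : (n - 1) * a / 2 + 0 = n * a / 2 - a / 2 := by ring
  rw [harg] at h
  have hprod : 2 * (Real.sin (n * a / 2) * Real.cos (n * a / 2 - a / 2)) =
      Real.sin (n * a - a / 2) + Real.sin (a / 2) := by
    rw [Real.sin_sub, Real.cos_sub, show (n : ℝ) * a = 2 * (n * a / 2) by ring, Real.sin_two_mul,
      Real.cos_two_mul, show 2 * (n * a / 2) / 2 = n * a / 2 by ring]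
    linear_combination 2 * Real.sin (a / 2) * Real.sin_sq_add_cos_sq (n * a / 2)
  have hneg : Real.sin (n * a - a / 2) = -(-1) ^ p * Real.sin (a / 2) := by
    rw [Real.sin_sub, ha, Real.sin_int_mul_pi, Real.cos_int_mul_pi]
    ring
  refine mul_left_cancel₀ hsin ?_
  simp only [add_zero, mul_comm a] at h
  linear_combination 2 * h + hprod + hneg

theorem chebNode_mem_Icc (k : Fin n) : chebNode n k ∈ Set.Icc (-1 : ℝ) 1 := Real.cos_mem_Icc _

theorem injective_chebNode : Function.Injective (chebNode n) := by
  intro i j hij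
  have hn : (0 : ℝ) < n := by exact_mod_cast i.pos
  have hmem : ∀ k : Fin n, (2 * (k : ℝ) + 1) * π / (2 * n) ∈ Set.Icc 0 π := fun k => by
    have hk : (k : ℝ) + 1 ≤ n := by exact_mod_cast k.isLt
    refine ⟨by positivity, ?_⟩
    rw [div_le_iff₀ (by positivity), mul_comm π]
    gcongr
    linarith
  have h := Real.injOn_cos (hmem i) (hmem j) hij
  have hpi := Real.pi_pos
  have : (i : ℝ) = j := by
    field_simp at h
    linarith
  exact Fin.ext (by exact_mod_cast this)

/-- Discrete orthogonality of the Chebyshev polynomials at the Chebyshev nodes. -/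
theorem sum_chebT_mul_chebT_chebNode (i k : Fin n) :
    1 / (n : ℝ) + (2 / (n : ℝ)) * ∑ m ∈ Finset.Icc 1 (n - 1),
      chebT m (chebNode n i) * chebT m (chebNode n k) = if i = k then 1 else 0 := by
  have hn : 0 < n := i.pos
  have hn0 : (0 : ℝ) < n := by exact_mod_cast hn
  set θ : Fin n → ℝ := fun k => (2 * (k : ℝ) + 1) * π / (2 * n) with hθ
  have hθ_pos : ∀ k, 0 < θ k := fun k => by positivity
  have hθ_lt : ∀ k, θ k < π := fun k => by
    have hk : (k : ℝ) + 1 ≤ n := by exact_mod_cast k.isLt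
    rw [hθ, div_lt_iff₀ (by positivity), mul_comm π]
    gcongr
    linarith
  have hT : ∀ (m : ℕ) (k : Fin n), chebT m (chebNode n k) = Real.cos (m * θ k) := fun m k => by
    rw [chebT, chebNode, Polynomial.Chebyshev.T_real_cos]
    rfl
  have hprod : ∀ m : ℕ, 2 * (chebT m (chebNode n i) * chebT m (chebNode n k)) =
      Real.cos (m * (θ i - θ k)) + Real.cos (m * (θ i + θ k)) := fun m => by
    rw [hT, hT, mul_sub, mul_add, Real.cos_sub, Real.cos_add]
    ring
  have hIcc : Finset.range n = insert 0 (Finset.Icc 1 (n - 1)) := by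
    ext m
    simp only [Finset.mem_range, Finset.mem_insert, Finset.mem_Icc]
    omega
  have hsplit : 2 + 2 * ∑ m ∈ Finset.Icc 1 (n - 1),
      chebT m (chebNode n i) * chebT m (chebNode n k) =
      ∑ m ∈ Finset.range n, Real.cos (m * (θ i - θ k)) +
        ∑ m ∈ Finset.range n, Real.cos (m * (θ i + θ k)) := by
    rw [← Finset.sum_add_distrib, hIcc, Finset.sum_insert (by simp), Finset.mul_sum]
    simp only [hprod, CharP.cast_eq_zero, zero_mul, Real.cos_zero]
    norm_num
  have hplus : 2 * ∑ m ∈ Finset.range n, Real.cos (m * (θ i + θ k)) =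
      1 - (-1) ^ ((i : ℤ) + k + 1) := by
    refine two_mul_sum_range_cos ?_ (Real.sin_pos_of_pos_of_lt_pi ?_ ?_).ne'
    · simp only [hθ]
      push_cast
      field_simp
      ring
    · linarith [hθ_pos i, hθ_pos k]
    · linarith [hθ_lt i, hθ_lt k]
  have hkey : (∑ m ∈ Finset.range n, Real.cos (m * (θ i - θ k)) +
      ∑ m ∈ Finset.range n, Real.cos (m * (θ i + θ k))) = if i = k then (n : ℝ) + 1 else 1 := by
    have hpar : ((-1 : ℝ)) ^ ((i : ℤ) + k + 1) = -(-1) ^ ((i : ℤ) - k) := by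
      have h1 : (i : ℤ) + k + 1 = (i - k) + (2 * k + 1) := by ring
      rw [h1, zpow_add₀ (by norm_num), Odd.neg_one_zpow ⟨_, rfl⟩]
      ring
    split_ifs with hik
    · subst hik
      simp only [sub_self, mul_zero, Real.cos_zero, Finset.sum_const, Finset.card_range,
        nsmul_eq_mul, mul_one]
      rw [hpar, sub_self, zpow_zero] at hplus
      linarith
    · have hne : θ i ≠ θ k := fun heq => hik (injective_chebNode (congrArg Real.cos heq))
      have hminus : 2 * ∑ m ∈ Finset.range n, Real.cos (m * (θ i - θ k)) =
          1 - (-1) ^ ((i : ℤ) - k) := by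
        refine two_mul_sum_range_cos ?_ ?_
        · simp only [hθ]
          push_cast
          field_simp
          ring
        · intro h0
          rw [Real.sin_eq_zero_iff_of_lt_of_lt (by linarith [hθ_lt k, hθ_pos i, Real.pi_pos])
            (by linarith [hθ_lt i, hθ_pos k, Real.pi_pos])] at h0
          exact hne (by linarith)
      rw [hpar] at hplus
      linarith
  rw [hkey] at hsplit
  have : 1 / (n : ℝ) + (2 / (n : ℝ)) * ∑ m ∈ Finset.Icc 1 (n - 1),
      chebT m (chebNode n i) * chebT m (chebNode n k) =
      ((2 + 2 * ∑ m ∈ Finset.Icc 1 (n - 1),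
        chebT m (chebNode n i) * chebT m (chebNode n k)) - 1) / n := by ring
  rw [this, hsplit]
  split_ifs
  · field_simp
    ring
  · simp

open Polynomial in
theorem chebBasis_eq_eval_basis (α β : ℝ) (i : Fin n) (x : ℝ) :
    chebBasis n α β i x =
      (Lagrange.basis Finset.univ (chebNode n) i).eval ((2 * x - (α + β)) / (α - β)) := by
  have hn : 0 < n := i.pos
  have hinj : Set.InjOn (chebNode n) (Finset.univ : Finset (Fin n)) := injective_chebNode.injOn
  set Q : ℝ[X] := C (1 / (n : ℝ)) + C (2 / (n : ℝ)) *
    ∑ m ∈ Finset.Icc 1 (n - 1), C (chebT m (chebNode n i)) * Chebyshev.T ℝ m with hQ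
  have heval : ∀ t : ℝ, Q.eval t = 1 / (n : ℝ) + (2 / (n : ℝ)) *
      ∑ m ∈ Finset.Icc 1 (n - 1), chebT m (chebNode n i) * chebT m t := fun t => by
    simp only [hQ, eval_add, eval_mul, eval_C, eval_finsetSum, chebT]
  rw [chebBasis, ← heval]
  congr 1
  refine eq_of_degrees_lt_of_eval_index_eq Finset.univ hinj ?_ ?_ fun k _ => ?_
  · rw [Finset.card_univ, Fintype.card_fin]
    refine (degree_add_le _ _).trans_lt (max_lt ?_ ?_)
    · exact degree_C_le.trans_lt (by exact_mod_cast hn)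
    · rw [← smul_eq_C_mul]
      refine (degree_smul_le _ _).trans_lt ((degree_sum_le _ _).trans_lt
        ((Finset.sup_lt_iff (WithBot.bot_lt_coe n)).mpr fun m hm => ?_))
      rw [← smul_eq_C_mul]
      refine (degree_smul_le _ _).trans_lt ?_
      rw [Chebyshev.degree_T, Int.natAbs_natCast]
      exact Nat.cast_lt.mpr (by have := (Finset.mem_Icc.mp hm).2; omega)
  · rw [Lagrange.degree_basis hinj (Finset.mem_univ i), Finset.card_univ, Fintype.card_fin]
    exact Nat.cast_lt.mpr (by omega)
  · rw [heval, sum_chebT_mul_chebT_chebNode]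
    split_ifs with hik
    · rw [hik, Lagrange.eval_basis_self hinj (Finset.mem_univ k)]
    · rw [Lagrange.eval_basis_of_ne hik (Finset.mem_univ k)]

theorem abs_eval_basis_chebNode (k : Fin n) (x : ℝ) :
    |(Lagrange.basis Finset.univ (chebNode n) k).eval x| =
      ∏ j ∈ Finset.univ.erase k, |x - chebNode n j| / |chebNode n k - chebNode n j| := by
  rw [Lagrange.basis, Polynomial.eval_prod, Finset.abs_prod]
  refine Finset.prod_congr rfl fun j _ => ?_
  simp only [Lagrange.basisDivisor, Polynomial.eval_mul, Polynomial.eval_C, Polynomial.eval_sub,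
    Polynomial.eval_X]
  rw [abs_mul, abs_inv, inv_mul_eq_div]

theorem sum_abs_eval_basis_le_lebesgueConst {x : ℝ} (hx : x ∈ Set.Icc (-1 : ℝ) 1) :
    ∑ k : Fin n, |(Lagrange.basis Finset.univ (chebNode n) k).eval x| ≤ lebesgueConst n := by
  have hsum : ∀ y : ℝ, ∑ k : Fin n, ∏ j ∈ Finset.univ.erase k,
      |y - chebNode n j| / |chebNode n k - chebNode n j| =
      ∑ k : Fin n, |(Lagrange.basis Finset.univ (chebNode n) k).eval y| := fun y =>
    Finset.sum_congr rfl fun k _ => (abs_eval_basis_chebNode k y).symm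
  have hcont : Continuous fun y : ℝ =>
      ∑ k : Fin n, |(Lagrange.basis Finset.univ (chebNode n) k).eval y| :=
    continuous_finsetSum _ fun k _ => (Polynomial.continuous _).abs
  obtain ⟨B, hB⟩ := (isCompact_Icc (a := (-1 : ℝ)) (b := 1)).bddAbove_image hcont.continuousOn
  rw [lebesgueConst]
  simp only [hsum]
  refine le_ciSup_of_le ⟨max B 0, ?_⟩ x (le_ciSup_of_le (Set.finite_range _).bddAbove hx le_rfl)
  rintro _ ⟨y, rfl⟩
  refine Real.iSup_le (fun hy => ?_) (le_max_right _ _)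
  exact (hB ⟨y, hy, rfl⟩).trans (le_max_left _ _)

theorem lebesgueConst_nonneg (n : ℕ) : 0 ≤ lebesgueConst n :=
  Real.iSup_nonneg fun _ => Real.iSup_nonneg fun _ =>
    Finset.sum_nonneg fun _ _ => Finset.prod_nonneg fun _ _ => by positivity

open Polynomial in
theorem sum_eval_mul_eval_basis {P : ℝ[X]} (hP : P.degree < n) (x : ℝ) :
    ∑ k : Fin n, P.eval (chebNode n k) *
      (Lagrange.basis Finset.univ (chebNode n) k).eval x = P.eval x := by
  have h := Lagrange.eq_interpolate (s := Finset.univ) (v := chebNode n) (f := P)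
    injective_chebNode.injOn (by rwa [Finset.card_univ, Fintype.card_fin])
  nth_rewrite 2 [h]
  simp [Lagrange.interpolate_apply, eval_finsetSum]

open Polynomial in
/-- The interpolation error is at most `1 + lebesgueConst n` times the error of any polynomial of
degree less than `n`. -/
theorem abs_sub_interpolation_le {P : ℝ[X]} (hP : P.degree < n) {g : ℝ → ℝ} {ε : ℝ}
    (h : ∀ x ∈ Set.Icc (-1 : ℝ) 1, |g x - P.eval x| ≤ ε) {x : ℝ} (hx : x ∈ Set.Icc (-1 : ℝ) 1) :
    |g x - ∑ k : Fin n, g (chebNode n k) *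
      (Lagrange.basis Finset.univ (chebNode n) k).eval x| ≤ (lebesgueConst n + 1) * ε := by
  have hε : 0 ≤ ε := (abs_nonneg _).trans (h x hx)
  have hsplit : g x - ∑ k : Fin n, g (chebNode n k) *
      (Lagrange.basis Finset.univ (chebNode n) k).eval x = (g x - P.eval x) -
      ∑ k : Fin n, (g (chebNode n k) - P.eval (chebNode n k)) *
        (Lagrange.basis Finset.univ (chebNode n) k).eval x := by
    simp only [sub_mul, Finset.sum_sub_distrib, sum_eval_mul_eval_basis hP]
    ring
  have hsum : |∑ k : Fin n, (g (chebNode n k) - P.eval (chebNode n k)) *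
      (Lagrange.basis Finset.univ (chebNode n) k).eval x| ≤ ε * lebesgueConst n := by
    refine (Finset.abs_sum_le_sum_abs _ _).trans ?_
    calc ∑ k : Fin n, |(g (chebNode n k) - P.eval (chebNode n k)) *
          (Lagrange.basis Finset.univ (chebNode n) k).eval x|
        ≤ ∑ k : Fin n, ε * |(Lagrange.basis Finset.univ (chebNode n) k).eval x| := by
          refine Finset.sum_le_sum fun k _ => ?_
          rw [abs_mul]
          gcongr
          exact h _ (chebNode_mem_Icc k)
      _ ≤ ε * lebesgueConst n := by
          rw [← Finset.mul_sum]
          gcongr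
          exact sum_abs_eval_basis_le_lebesgueConst hx
  rw [hsplit]
  refine (abs_sub _ _).trans ?_
  linarith [h x hx]

end ChebyshevInterpolation

section AffineTransport

theorem iteratedDeriv_comp_affine (h : ℝ → ℝ) (a b : ℝ) (v : ℕ) (t : ℝ) :
    iteratedDeriv v (fun t => h (a * t + b)) t = a ^ v * iteratedDeriv v h (a * t + b) := by
  induction v generalizing t with
  | zero => simp
  | succ v ih =>
    rw [iteratedDeriv_succ, funext ih, iteratedDeriv_succ, deriv_const_mul_field,
      deriv_comp_mul_left a (fun y => iteratedDeriv v h (y + b)) t, deriv_comp_add_const,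
      smul_eq_mul, pow_succ]
    ring

variable {h : ℝ → ℝ} {α β : ℝ}

theorem scaledChebNode_mem_Icc {n : ℕ} (hab : α < β) (k : Fin n) :
    scaledChebNode n α β k ∈ Set.Icc α β := by
  obtain ⟨h1, h2⟩ := chebNode_mem_Icc k
  constructor <;> rw [scaledChebNode] <;> nlinarith

theorem affine_inv_mem_Icc (hab : α < β) {x : ℝ} (hx : x ∈ Set.Icc α β) :
    (2 * x - (α + β)) / (α - β) ∈ Set.Icc (-1 : ℝ) 1 := by
  have hneg : α - β < 0 := sub_neg.mpr hab
  constructor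
  · rw [le_div_iff_of_neg hneg]
    linarith [hx.2]
  · rw [div_le_iff_of_neg hneg]
    linarith [hx.1]

theorem sum_abs_chebBasis_le {n : ℕ} (hab : α < β) {x : ℝ} (hx : x ∈ Set.Icc α β) :
    ∑ k : Fin n, |chebBasis n α β k x| ≤ lebesgueConst n := by
  simp only [chebBasis_eq_eval_basis]
  exact sum_abs_eval_basis_le_lebesgueConst (affine_inv_mem_Icc hab hx)

/-- Univariate Chebyshev interpolation error on `[α, β]`, for an interval of length at most `d`. -/
theorem abs_sub_sum_chebBasis_le {C γ d : ℝ} {k n : ℕ} (hC : 0 ≤ C) (hγ : 0 < γ) (hn : 1 ≤ n)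
    (hab : α < β) (hd : β - α ≤ d) (hh : ContDiffOn ℝ (⊤ : ℕ∞) h (Set.Icc α β))
    (hder : ∀ y ∈ Set.Icc α β, ∀ v : ℕ, |iteratedDeriv v h y| ≤
      C * (Nat.factorial (v + k) : ℝ) / (γ ^ v * (Nat.factorial k : ℝ)))
    {x : ℝ} (hx : x ∈ Set.Icc α β) :
    |h x - ∑ i : Fin n, h (scaledChebNode n α β i) * chebBasis n α β i x| ≤
      (lebesgueConst n + 1) * (2 * Real.exp 1 * C * ((n : ℝ) + 1) ^ (k + 1) * (1 + d / γ) *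
        (varsigma (2 * γ / d))⁻¹ ^ n) := by
  have hpos : 0 < β - α := sub_pos.mpr hab
  set r : ℝ := 2 * γ / (β - α) with hr_def
  have hr : 0 < r := by positivity
  set a : ℝ := (α - β) / 2 with ha
  set b : ℝ := (α + β) / 2 with hb
  have hmaps : Set.MapsTo (fun t => a * t + b) (Set.Icc (-1 : ℝ) 1) (Set.Icc α β) :=
    fun t ht => by
      obtain ⟨h1, h2⟩ := ht
      constructor <;> simp only [ha, hb] <;> nlinarith
  have hg : ContDiffOn ℝ (⊤ : ℕ∞) (fun t => h (a * t + b)) (Set.Icc (-1 : ℝ) 1) :=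
    hh.comp (((contDiff_const.mul contDiff_id).add contDiff_const).contDiffOn) hmaps
  have hscale : |a| = γ / r := by
    rw [ha, abs_of_neg (by linarith), hr_def]
    field_simp
    ring
  obtain ⟨P, hdeg, hP⟩ := exists_polynomial_near_of_iteratedDeriv_le
    (g := fun t => h (a * t + b)) (C := C) (r := r) (k := k) hC hr hn hg.continuousOn
    (hg.mono Set.Ioo_subset_Icc_self) fun y hy v => by
      rw [iteratedDeriv_comp_affine, abs_mul, abs_pow, hscale]
      calc (γ / r) ^ v * |iteratedDeriv v h (a * y + b)|
          ≤ (γ / r) ^ v *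
              (C * (Nat.factorial (v + k) : ℝ) / (γ ^ v * (Nat.factorial k : ℝ))) := by
            gcongr
            exact hder _ (hmaps (Set.Ioo_subset_Icc_self hy)) v
        _ = C * (Nat.factorial (v + k) : ℝ) / (r ^ v * (Nat.factorial k : ℝ)) := by
            rw [div_pow]
            field_simp
  have hle := abs_sub_interpolation_le hdeg hP (affine_inv_mem_Icc hab hx)
  have hne : α - β ≠ 0 := (sub_neg.mpr hab).ne
  have hxinv : a * ((2 * x - (α + β)) / (α - β)) + b = x := by
    rw [ha, hb]
    field_simp
    ring
  simp only [hxinv] at hle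
  simp only [chebBasis_eq_eval_basis, scaledChebNode]
  refine hle.trans ?_
  have hd0 : 0 < d := hpos.trans_le hd
  have h2r : 2 / r ≤ d / γ := by
    rw [hr_def, div_div_eq_mul_div, mul_div_mul_left _ _ two_ne_zero]
    gcongr
  have hςle : (varsigma r)⁻¹ ≤ (varsigma (2 * γ / d))⁻¹ :=
    inv_anti₀ (varsigma_pos _) (varsigma_mono (by positivity) (by rw [hr_def]; gcongr))
  have hς0 : 0 ≤ (varsigma r)⁻¹ := inv_nonneg.mpr (varsigma_pos r).le
  have hL := lebesgueConst_nonneg n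
  gcongr

end AffineTransport

section TensorProduct

/-- Tensor-product interpolation error from the errors in each coordinate direction. -/
theorem abs_sub_tensor_interpolation_le {n : ℕ} {L ε : ℝ} (hL : 0 ≤ L) (hε : 0 ≤ ε) {D : ℕ}
    (S : Fin D → Set ℝ) (η : Fin D → Fin n → ℝ) (hη : ∀ j k, η j k ∈ S j)
    (l : Fin D → Fin n → ℝ → ℝ) (hl : ∀ j, ∀ x ∈ S j, ∑ k, |l j k x| ≤ L)
    (F : (Fin D → ℝ) → ℝ)
    (hF : ∀ x ∈ Set.univ.pi S, ∀ j,
      |F x - ∑ k, F (Function.update x j (η j k)) * l j k (x j)| ≤ (L + 1) * ε)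
    {x : Fin D → ℝ} (hx : x ∈ Set.univ.pi S) :
    |F x - ∑ i : Fin D → Fin n, F (fun j => η j (i j)) * ∏ j, l j (i j) (x j)| ≤
      D * (L + 1) ^ D * ε := by
  induction D with
  | zero =>
    rw [Subsingleton.elim x fun j => j.elim0]
    simp [Subsingleton.elim (fun j : Fin 0 => η j _) fun j => j.elim0]
  | succ D ih =>
    have hmem : ∀ k, ∀ y ∈ Set.univ.pi (fun j : Fin D => S j.succ),
        (Fin.cons (η 0 k) y : Fin (D + 1) → ℝ) ∈ Set.univ.pi S := fun k y hy j _ => by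
      refine Fin.cases ?_ (fun j => ?_) j
      · exact hη 0 k
      · exact hy j (Set.mem_univ j)
    have htail : Fin.tail x ∈ Set.univ.pi (fun j : Fin D => S j.succ) :=
      fun j _ => hx j.succ (Set.mem_univ _)
    have hinner : ∀ k, |F (Fin.cons (η 0 k) (Fin.tail x)) -
        ∑ i : Fin D → Fin n, F (Fin.cons (η 0 k) fun j => η j.succ (i j)) *
          ∏ j, l j.succ (i j) (Fin.tail x j)| ≤ D * (L + 1) ^ D * ε := fun k =>
      ih (fun j => S j.succ) (fun j => η j.succ) (fun j => hη j.succ) (fun j => l j.succ)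
        (fun j => hl j.succ) (fun y => F (Fin.cons (η 0 k) y)) (fun y hy j => by
          simpa only [Fin.cons_update, Fin.cons_succ] using hF _ (hmem k y hy) j.succ) htail
    have hx0 : x 0 ∈ S 0 := hx 0 (Set.mem_univ _)
    have hfirst := hF x hx 0
    have hupdate : ∀ a, Function.update x 0 a = Fin.cons a (Fin.tail x) := fun a => by
      rw [← Fin.update_cons_zero (x 0) (Fin.tail x) a, Fin.cons_self_tail]
    simp only [hupdate] at hfirst
    have hsum : ∑ i : Fin (D + 1) → Fin n, F (fun j => η j (i j)) * ∏ j, l j (i j) (x j) =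
        ∑ k, l 0 k (x 0) * ∑ i : Fin D → Fin n, F (Fin.cons (η 0 k) fun j => η j.succ (i j)) *
          ∏ j, l j.succ (i j) (Fin.tail x j) := by
      rw [← (Fin.consEquiv fun _ => Fin n).sum_comp, Fintype.sum_prod_type]
      refine Finset.sum_congr rfl fun k _ => ?_
      rw [Finset.mul_sum]
      refine Finset.sum_congr rfl fun i _ => ?_
      have hcons : (fun j => η j ((Fin.cons k i : Fin (D + 1) → Fin n) j)) =
          Fin.cons (η 0 k) fun j => η j.succ (i j) := by
        funext j
        refine Fin.cases ?_ (fun j => ?_) j <;> simp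
      simp only [Fin.consEquiv_apply, hcons, Fin.prod_univ_succ, Fin.cons_zero, Fin.cons_succ,
        Fin.tail]
      ring
    set A : Fin n → ℝ := fun k => F (Fin.cons (η 0 k) (Fin.tail x)) with hA
    set B : Fin n → ℝ := fun k => ∑ i : Fin D → Fin n,
      F (Fin.cons (η 0 k) fun j => η j.succ (i j)) * ∏ j, l j.succ (i j) (Fin.tail x j) with hB
    have hsplit : F x - ∑ k, l 0 k (x 0) * B k =
        (F x - ∑ k, A k * l 0 k (x 0)) + ∑ k, (A k - B k) * l 0 k (x 0) := by
      simp only [sub_mul, Finset.sum_sub_distrib, mul_comm (B _)]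
      ring
    have hsecond : |∑ k, (A k - B k) * l 0 k (x 0)| ≤ D * (L + 1) ^ D * ε * L := by
      refine (Finset.abs_sum_le_sum_abs _ _).trans ?_
      calc ∑ k, |(A k - B k) * l 0 k (x 0)|
          ≤ ∑ k, D * (L + 1) ^ D * ε * |l 0 k (x 0)| := by
            refine Finset.sum_le_sum fun k _ => ?_
            rw [abs_mul]
            gcongr
            exact hinner k
        _ ≤ D * (L + 1) ^ D * ε * L := by
            rw [← Finset.mul_sum]
            gcongr
            exact hl 0 _ hx0
    rw [hsum, hsplit]
    refine (abs_add_le _ _).trans ((add_le_add hfirst hsecond).trans ?_)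
    have hpow : (L + 1) ≤ (L + 1) ^ (D + 1) := le_self_pow₀ (by linarith) (by omega)
    calc (L + 1) * ε + D * (L + 1) ^ D * ε * L
        ≤ (L + 1) ^ (D + 1) * ε + D * (L + 1) ^ D * ε * (L + 1) := by
          gcongr
          linarith
      _ = ((D + 1 : ℕ) : ℝ) * (L + 1) ^ (D + 1) * ε := by
          push_cast
          ring

/-- Perturbing the coefficients of a tensor-product expansion. -/
theorem abs_sum_mul_prod_le {n D : ℕ} {L K : ℝ} (hK : 0 ≤ K)
    (c : (Fin D → Fin n) → ℝ) (hc : ∀ i, |c i| ≤ K) (w : Fin D → Fin n → ℝ)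
    (hw : ∀ j, ∑ k, |w j k| ≤ L) :
    |∑ i : Fin D → Fin n, c i * ∏ j, w j (i j)| ≤ L ^ D * K := by
  refine (Finset.abs_sum_le_sum_abs _ _).trans ?_
  calc ∑ i : Fin D → Fin n, |c i * ∏ j, w j (i j)|
      ≤ ∑ i : Fin D → Fin n, K * ∏ j, |w j (i j)| := by
        refine Finset.sum_le_sum fun i _ => ?_
        rw [abs_mul, Finset.abs_prod]
        gcongr
        exact hc i
    _ = K * ∏ j, ∑ k, |w j k| := by
        rw [← Finset.mul_sum, Finset.prod_univ_sum, Fintype.piFinset_univ]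
    _ ≤ K * L ^ D := by
        gcongr
        calc ∏ j, ∑ k, |w j k| ≤ ∏ _j : Fin D, L :=
              Finset.prod_le_prod (fun _ _ => Finset.sum_nonneg fun _ _ => abs_nonneg _)
                fun j _ => hw j
          _ = L ^ D := by simp
    _ = L ^ D * K := mul_comm _ _

end TensorProduct

/-- Proposition 3.1 of the paper: for a smooth function `f` on the box
`Ξ = ∏ [α_i, β_i]` satisfying the stated derivative growth bound, with `M` the
tensor of samples of `f` at the grid of scaled Chebyshev nodes, the error of the
interpolant built from any tensor `M̂` is bounded by
`E(n) + λ_{n−1}^D · ‖M − M̂‖_C` at every point `ξ ∈ Ξ`. -/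
theorem cheb_tt_interpolation_error (D n : ℕ) (hD : 1 ≤ D) (hn : 1 ≤ n)
    (α β : Fin D → ℝ) (hab : ∀ i, α i < β i)
    (f : (Fin D → ℝ) → ℝ)
    (hf : ContDiffOn ℝ (⊤ : ℕ∞) f (Set.univ.pi fun i => Set.Icc (α i) (β i)))
    (Cf γf : ℝ) (hCf : 0 ≤ Cf) (hγf : 0 < γf) (σ : ℕ) (hσ : 1 ≤ σ)
    (hderiv : ∀ x ∈ (Set.univ.pi fun i => Set.Icc (α i) (β i)), ∀ i : Fin D, ∀ v : ℕ,
      |iteratedDeriv v (fun t => f (Function.update x i t)) (x i)| ≤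
        Cf * (Nat.factorial (v + σ - 1) : ℝ) / (γf ^ v * (Nat.factorial (σ - 1) : ℝ)))
    (M : (Fin D → Fin n) → ℝ)
    (hM : ∀ i, M i = f (fun j => scaledChebNode n (α j) (β j) (i j)))
    (Mhat : (Fin D → Fin n) → ℝ)
    (ξ : Fin D → ℝ) (hξ : ξ ∈ (Set.univ.pi fun i => Set.Icc (α i) (β i))) :
    |f ξ - ∑ i : Fin D → Fin n, Mhat i * ∏ j : Fin D, chebBasis n (α j) (β j) (i j) (ξ j)| ≤
      Equant D Cf γf (⨆ i : Fin D, (β i - α i)) σ n +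
        (lebesgueConst n) ^ D * (⨆ i : Fin D → Fin n, |M i - Mhat i|) := by
  obtain ⟨k, rfl⟩ : ∃ k, σ = k + 1 := ⟨σ - 1, by omega⟩
  simp only [← add_assoc, Nat.add_sub_cancel] at hderiv
  set d : ℝ := ⨆ i : Fin D, (β i - α i) with hd
  have hlen : ∀ j, β j - α j ≤ d := fun j =>
    le_ciSup (f := fun i => β i - α i) (Set.finite_range _).bddAbove j
  have hd0 : 0 < d := (sub_pos.mpr (hab ⟨0, hD⟩)).trans_le (hlen ⟨0, hD⟩)
  have hL := lebesgueConst_nonneg n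
  set ε : ℝ := 2 * Real.exp 1 * Cf * ((n : ℝ) + 1) ^ (k + 1) * (1 + d / γf) *
    (varsigma (2 * γf / d))⁻¹ ^ n with hε_def
  have hς := (varsigma_pos (2 * γf / d)).le
  have hε : 0 ≤ ε := by positivity
  have hfirst : |f ξ - ∑ i : Fin D → Fin n, M i * ∏ j, chebBasis n (α j) (β j) (i j) (ξ j)| ≤
      D * (lebesgueConst n + 1) ^ D * ε := by
    simp only [hM]
    refine abs_sub_tensor_interpolation_le hL hε (fun j => Set.Icc (α j) (β j))
      (fun j => scaledChebNode n (α j) (β j)) (fun j k => scaledChebNode_mem_Icc (hab j) k)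
      (fun j => chebBasis n (α j) (β j)) (fun j x hx => sum_abs_chebBasis_le (hab j) hx) f
      (fun x hx j => ?_) hξ
    have hmaps : Set.MapsTo (Function.update x j) (Set.Icc (α j) (β j))
        (Set.univ.pi fun i => Set.Icc (α i) (β i)) := fun t ht =>
      (Set.update_mem_pi_iff_of_mem hx).mpr fun _ => ht
    have hline := abs_sub_sum_chebBasis_le (h := fun t => f (Function.update x j t)) hCf hγf hn
      (hab j) (hlen j) (hf.comp (contDiff_update _ x j).contDiffOn hmaps) (fun y hy v => by
        simpa only [Function.update_idem, Function.update_self] using hderiv _ (hmaps hy) j v)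
      (hx j (Set.mem_univ j))
    simpa only [Function.update_eq_self] using hline
  have hsecond := abs_sum_mul_prod_le (K := ⨆ i : Fin D → Fin n, |M i - Mhat i|)
    (Real.iSup_nonneg fun _ => abs_nonneg _) (fun i => M i - Mhat i)
    (fun i => le_ciSup (f := fun i => |M i - Mhat i|) (Set.finite_range _).bddAbove i)
    (fun j k => chebBasis n (α j) (β j) k (ξ j))
    fun j => sum_abs_chebBasis_le (hab j) (hξ j (Set.mem_univ j))
  have hsplit : f ξ - ∑ i : Fin D → Fin n, Mhat i * ∏ j, chebBasis n (α j) (β j) (i j) (ξ j) =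
      (f ξ - ∑ i : Fin D → Fin n, M i * ∏ j, chebBasis n (α j) (β j) (i j) (ξ j)) +
        ∑ i : Fin D → Fin n, (M i - Mhat i) * ∏ j, chebBasis n (α j) (β j) (i j) (ξ j) := by
    simp only [sub_mul, Finset.sum_sub_distrib]
    ring
  rw [hsplit]
  refine (abs_add_le _ _).trans (add_le_add (hfirst.trans_eq ?_) hsecond)
  rw [Equant, hε_def]
  ring
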